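/- Let Ψ be the suspension flow over a bi-Lipschitz map T : X → X (X compact) with Lipschitz height function φ > 0, with base measure μ and suspension measure ν given by ∫ g dν = (∫_X ∫₀^{φ(x)} g(x,s) ds dμ(x)) / ∫φ dμ. If the correlation dimension C_μ of μ exists, then the correlation dimension of ν with respect to the Bowen–Walters metric exists and C_ν = C_μ + 1. -/

import Mathlib

open MeasureTheory Filter Metric Topology

/-- Correlation integral: `∫ μ(B(x,r)) dμ(x)`. -/
noncomputable def corrIntegral {X : Type*} [PseudoMetricSpace X] [MeasurableSpace X]
    (μ : Measure X) (r : ℝ) : ℝ :=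
  ∫ x, (μ (ball x r)).toReal ∂μ

/-- The flow on (representatives of) the unit suspension of the invertible map `e`. -/
noncomputable def unitSuspFlow {X : Type*} (e : Equiv.Perm X) (r : ℝ) (p : X × ℝ) : X × ℝ :=
  ((e ^ (⌊p.2 + r⌋ : ℤ)) p.1, Int.fract (p.2 + r))

/-- Admissible segment lengths (horizontal or vertical) in the unit suspension. -/
def IsSegLen {X : Type*} [PseudoMetricSpace X] (e : Equiv.Perm X)
    (p q : X × ℝ) (ℓ : ℝ) : Prop :=
  (p.2 = q.2 ∧ ℓ = (1 - p.2) * dist p.1 q.1 + p.2 * dist (e p.1) (e q.1)) ∨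
  (∃ r : ℝ, unitSuspFlow e r p = q ∧ ℓ = |r|)

/-- The Bowen–Walters distance on the unit suspension. -/
noncomputable def bwUnitDist {X : Type*} [PseudoMetricSpace X] (e : Equiv.Perm X)
    (p q : X × ℝ) : ℝ :=
  sInf {L : ℝ | ∃ n : ℕ, ∃ z : ℕ → X × ℝ, ∃ ℓ : ℕ → ℝ,
    z 0 = p ∧ z n = q ∧ (∀ i < n, IsSegLen e (z i) (z (i + 1)) (ℓ i)) ∧
    L = ∑ i ∈ Finset.range n, ℓ i}

/-- The Bowen–Walters distance on the suspension with height function `φ`. -/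
noncomputable def bwDist {X : Type*} [PseudoMetricSpace X] (e : Equiv.Perm X)
    (φ : X → ℝ) (p q : X × ℝ) : ℝ :=
  bwUnitDist e (p.1, p.2 / φ p.1) (q.1, q.2 / φ q.1)

/-- `SegChain e p q ℓ`: some finite chain of admissible segments from `p` to `q` has length `ℓ`. -/
inductive SegChain {X : Type*} [PseudoMetricSpace X] (e : Equiv.Perm X) (p : X × ℝ) :
    X × ℝ → ℝ → Prop
  | refl : SegChain e p p 0
  | snoc {q q' : X × ℝ} {a b : ℝ} :
      SegChain e p q a → IsSegLen e q q' b → SegChain e p q' (a + b)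

section Chain

variable {X : Type*} [PseudoMetricSpace X] {e : Equiv.Perm X}

theorem SegChain.trans {p q q' : X × ℝ} {a b : ℝ} (h : SegChain e p q a)
    (h' : SegChain e q q' b) : SegChain e p q' (a + b) := by
  induction h' with
  | refl => simpa using h
  | snoc _ hs ih => rw [← add_assoc]; exact ih.snoc hs

theorem segChain_iff {p q : X × ℝ} {a : ℝ} :
    SegChain e p q a ↔ ∃ n : ℕ, ∃ z : ℕ → X × ℝ, ∃ ℓ : ℕ → ℝ,
      z 0 = p ∧ z n = q ∧ (∀ i < n, IsSegLen e (z i) (z (i + 1)) (ℓ i)) ∧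
      a = ∑ i ∈ Finset.range n, ℓ i := by
  constructor
  · intro h
    induction h with
    | refl => exact ⟨0, fun _ => p, fun _ => 0, rfl, rfl, by simp, by simp⟩
    | @snoc q q' a b _ hs ih =>
      obtain ⟨n, z, ℓ, h0, hn, hseg, hsum⟩ := ih
      refine ⟨n + 1, fun i => if i ≤ n then z i else q', fun i => if i < n then ℓ i else b,
        by simpa using h0, by simp, ?_, ?_⟩
      · intro i hi
        rcases Nat.lt_succ_iff_lt_or_eq.mp hi with h | h
        · simpa [h, h.le, Nat.succ_le_of_lt h] using hseg i h
        · subst h; simpa [hn] using hs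
      · rw [Finset.sum_range_succ, hsum]
        simp only [lt_irrefl, if_false]
        congr 1
        exact Finset.sum_congr rfl fun i hi => by simp [Finset.mem_range.mp hi]
  · rintro ⟨n, z, ℓ, rfl, rfl, hseg, rfl⟩
    induction n with
    | zero => simpa using SegChain.refl
    | succ n ih =>
      rw [Finset.sum_range_succ]
      exact (ih fun i hi => hseg i (hi.trans n.lt_succ_self)).snoc (hseg n n.lt_succ_self)

theorem bwUnitDist_eq_sInf (p q : X × ℝ) :
    bwUnitDist e p q = sInf {a | SegChain e p q a} := by
  simp only [bwUnitDist, segChain_iff]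

theorem IsSegLen.nonneg {p q : X × ℝ} {a : ℝ} (hp : p.2 ∈ Set.Ico (0 : ℝ) 1)
    (h : IsSegLen e p q a) : 0 ≤ a := by
  rcases h with ⟨_, rfl⟩ | ⟨r, _, rfl⟩
  · have := hp.1
    have : 0 ≤ 1 - p.2 := by linarith [hp.2]
    positivity
  · positivity

theorem IsSegLen.mem_Ico {p q : X × ℝ} {a : ℝ} (hp : p.2 ∈ Set.Ico (0 : ℝ) 1)
    (h : IsSegLen e p q a) : q.2 ∈ Set.Ico (0 : ℝ) 1 := by
  rcases h with ⟨h, _⟩ | ⟨r, rfl, _⟩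
  · rwa [← h]
  · exact ⟨Int.fract_nonneg _, Int.fract_lt_one _⟩

theorem SegChain.mem_Ico {p q : X × ℝ} {a : ℝ} (hp : p.2 ∈ Set.Ico (0 : ℝ) 1)
    (h : SegChain e p q a) : q.2 ∈ Set.Ico (0 : ℝ) 1 := by
  induction h with
  | refl => exact hp
  | snoc _ hs ih => exact hs.mem_Ico ih

theorem SegChain.nonneg {p q : X × ℝ} {a : ℝ} (hp : p.2 ∈ Set.Ico (0 : ℝ) 1)
    (h : SegChain e p q a) : 0 ≤ a := by
  induction h with
  | refl => exact le_rfl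
  | snoc h hs ih => exact add_nonneg ih (hs.nonneg (h.mem_Ico hp))

/-- A chain made of one vertical and one horizontal segment. -/
theorem exists_segChain_le {L : ℝ} (hL : 1 ≤ L)
    (he : ∀ x y : X, dist (e x) (e y) ≤ L * dist x y) {p q : X × ℝ}
    (hq : q.2 ∈ Set.Ico (0 : ℝ) 1) :
    ∃ a ≤ L * dist p.1 q.1 + |p.2 - q.2|, SegChain e p q a := by
  have hv : IsSegLen e p (p.1, q.2) |q.2 - p.2| := by
    refine Or.inr ⟨q.2 - p.2, ?_, rfl⟩
    have h : p.2 + (q.2 - p.2) = q.2 := by ring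
    simp [unitSuspFlow, Int.floor_eq_zero_iff.mpr hq, Int.fract_eq_self.mpr hq]
  have hh : IsSegLen e (p.1, q.2) q
      ((1 - q.2) * dist p.1 q.1 + q.2 * dist (e p.1) (e q.1)) := Or.inl ⟨rfl, rfl⟩
  refine ⟨_, ?_, (SegChain.refl.snoc hv).snoc hh⟩
  rw [abs_sub_comm]
  have h1 := mul_le_mul_of_nonneg_left (he p.1 q.1) hq.1
  have h2 : (1 - q.2) * dist p.1 q.1 ≤ (1 - q.2) * (L * dist p.1 q.1) :=
    mul_le_mul_of_nonneg_left (le_mul_of_one_le_left dist_nonneg hL) (by linarith [hq.2])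
  linarith

theorem bwUnitDist_lt_iff {L : ℝ} (hL : 1 ≤ L)
    (he : ∀ x y : X, dist (e x) (e y) ≤ L * dist x y) {p q : X × ℝ}
    (hp : p.2 ∈ Set.Ico (0 : ℝ) 1) (hq : q.2 ∈ Set.Ico (0 : ℝ) 1) {r : ℝ} :
    bwUnitDist e p q < r ↔ ∃ a < r, SegChain e p q a := by
  obtain ⟨a, _, ha⟩ := exists_segChain_le hL he (p := p) hq
  have hbdd : BddBelow {a | SegChain e p q a} := ⟨0, fun b hb => SegChain.nonneg hp hb⟩
  rw [bwUnitDist_eq_sInf, csInf_lt_iff hbdd ⟨a, ha⟩]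
  simp only [Set.mem_ofPred_eq, and_comm]

/-- A chain of length less than `1` lifts to the product `X × ℝ` without much displacement. -/
theorem SegChain.exists_lift {L : ℝ} (hL : 1 ≤ L)
    (he : ∀ x y : X, dist (e x) (e y) ≤ L * dist x y)
    (he' : ∀ x y : X, dist (e.symm x) (e.symm y) ≤ L * dist x y) {p q : X × ℝ} {a : ℝ}
    (hp : p.2 ∈ Set.Ico (0 : ℝ) 1) (h : SegChain e p q a) (ha : a < 1) :
    ∃ n : ℤ, (n = -1 ∨ n = 0 ∨ n = 1) ∧ |q.2 + n - p.2| ≤ a ∧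
      dist ((e ^ (-n)) q.1) p.1 ≤ L ^ 2 * a := by
  induction h with
  | refl => exact ⟨0, by simp⟩
  | @snoc q q' a b hc hs ih =>
    have hq := hc.mem_Ico hp
    have hq' := hs.mem_Ico hq
    have hb := hs.nonneg hq
    obtain ⟨n, hn, hv, hd⟩ := ih (by linarith)
    have key : ∃ k : ℤ, |q'.2 + k - p.2| ≤ a + b ∧
        dist ((e ^ (-k)) q'.1) p.1 ≤ L ^ 2 * (a + b) := by
      rcases hs with ⟨hh, hb'⟩ | ⟨r, rfl, rfl⟩
      · refine ⟨n, by rw [← hh]; linarith, ?_⟩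
        have hL0 : 0 ≤ L := by linarith
        have h1 : dist q.1 q'.1 ≤ L * dist (e q.1) (e q'.1) := by
          simpa using he' (e q.1) (e q'.1)
        have h2 : dist q.1 q'.1 ≤ L * b := by
          have h3 := mul_le_mul_of_nonneg_left h1 hq.1
          have h4 : (1 - q.2) * dist q.1 q'.1 ≤ (1 - q.2) * (L * dist q.1 q'.1) :=
            mul_le_mul_of_nonneg_left (le_mul_of_one_le_left dist_nonneg hL)
              (by linarith [hq.2])
          rw [hb']
          linarith
        have h5 : dist ((e ^ (-n)) q'.1) ((e ^ (-n)) q.1) ≤ L * dist q.1 q'.1 := by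
          rw [dist_comm]
          rcases hn with rfl | rfl | rfl
          · simpa using he q.1 q'.1
          · simpa using le_mul_of_one_le_left dist_nonneg hL
          · simpa [Equiv.Perm.inv_def] using he' q.1 q'.1
        have h6 := dist_triangle ((e ^ (-n)) q'.1) ((e ^ (-n)) q.1) p.1
        have h7 := mul_le_mul_of_nonneg_left h2 hL0
        nlinarith
      · refine ⟨n + ⌊q.2 + r⌋, ?_, ?_⟩
        · have h1 : (unitSuspFlow e r q).2 + ((n + ⌊q.2 + r⌋ : ℤ) : ℝ) - p.2
              = (q.2 + n - p.2) + r := by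
            have := Int.fract_add_floor (q.2 + r)
            simp only [unitSuspFlow]
            push_cast
            linarith
          rw [h1]
          exact (abs_add_le _ _).trans (by linarith)
        · have h1 : (e ^ (-(n + ⌊q.2 + r⌋))) (unitSuspFlow e r q).1 = (e ^ (-n)) q.1 := by
            simp only [unitSuspFlow]
            rw [← Equiv.Perm.mul_apply, ← zpow_add]
            congr 2
            ring
          rw [h1]
          exact hd.trans (mul_le_mul_of_nonneg_left (by linarith) (by positivity))
    obtain ⟨k, hkv, hkd⟩ := key
    refine ⟨k, ?_, hkv, hkd⟩
    have h1 := abs_le.mp hkv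
    have h2 : (k : ℝ) < 2 := by linarith [hq'.1, hp.2]
    have h3 : (-2 : ℝ) < k := by linarith [hq'.2, hp.1]
    have h2' : k < 2 := by exact_mod_cast h2
    have h3' : -2 < k := by exact_mod_cast h3
    omega

/-- Within the fundamental domain, nearness for the Bowen–Walters distance is a relatively
open condition. -/
theorem exists_isOpen_segChain {L : ℝ} (hL : 1 ≤ L)
    (he : ∀ x y : X, dist (e x) (e y) ≤ L * dist x y) (r : ℝ) :
    ∃ U : Set ((X × ℝ) × X × ℝ), IsOpen U ∧ ∀ w : (X × ℝ) × X × ℝ,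
      w.1.2 ∈ Set.Ico (0 : ℝ) 1 → w.2.2 ∈ Set.Ico (0 : ℝ) 1 →
      (w ∈ U ↔ ∃ a < r, SegChain e w.1 w.2 a) := by
  refine ⟨⋃ w : (X × ℝ) × X × ℝ, ⋃ a : ℝ, ⋃ _ : w.1.2 ∈ Set.Ico (0 : ℝ) 1 ∧ SegChain e w.1 w.2 a,
    {w' | (L * dist w'.1.1 w.1.1 + |w'.1.2 - w.1.2|) + a
      + (L * dist w.2.1 w'.2.1 + |w.2.2 - w'.2.2|) < r}, ?_, ?_⟩
  · refine isOpen_iUnion fun w => isOpen_iUnion fun a => isOpen_iUnion fun _ => ?_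
    exact isOpen_lt (by fun_prop) continuous_const
  · intro w' h1 h2
    simp only [Set.mem_iUnion, Set.mem_ofPred_eq]
    constructor
    · rintro ⟨w, a, ⟨hw, hc⟩, hlt⟩
      obtain ⟨b, hb, hb'⟩ := exists_segChain_le hL he (p := w'.1) hw
      obtain ⟨c, hc', hc''⟩ := exists_segChain_le hL he (p := w.2) h2
      exact ⟨b + a + c, by linarith, (hb'.trans hc).trans hc''⟩
    · rintro ⟨a, ha, hc⟩
      exact ⟨w', a, ⟨h1, hc⟩, by simpa using ha⟩

end Chain

/-- Rescaling both the argument and the value of a function, and multiplying it by `r`, raises its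
power-law exponent at `0` by one. -/
theorem tendsto_log_mul_comp_div_log {C : ℝ → ℝ} {c a k : ℝ} (ha : 0 < a) (hk : 0 < k)
    (hC : ∀ r, 0 < r → 0 < C r)
    (h : Tendsto (fun r : ℝ => Real.log (C r) / Real.log r) (𝓝[>] 0) (𝓝 c)) :
    Tendsto (fun r : ℝ => Real.log (k * r * C (a * r)) / Real.log r) (𝓝[>] 0) (𝓝 (c + 1)) := by
  have hlog := Real.tendsto_log_nhdsGT_zero
  have h0 (b : ℝ) : Tendsto (fun r : ℝ => Real.log b / Real.log r) (𝓝[>] 0) (𝓝 0) :=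
    hlog.const_div_atBot _
  have hscale : Tendsto (fun r : ℝ => a * r) (𝓝[>] 0) (𝓝[>] 0) := by
    refine tendsto_nhdsWithin_iff.mpr ⟨?_, ?_⟩
    · have : Tendsto (fun r : ℝ => a * r) (𝓝 0) (𝓝 (a * 0)) := tendsto_id.const_mul a
      rw [mul_zero] at this
      exact this.mono_left nhdsWithin_le_nhds
    · filter_upwards [self_mem_nhdsWithin] with r hr using mul_pos ha hr
  have hlim := ((h0 k).add_const 1).add ((h.comp hscale).mul ((h0 a).add_const 1))
  rw [show (0 + 1 + c * (0 + 1) : ℝ) = c + 1 by ring] at hlim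
  refine hlim.congr' ?_
  filter_upwards [self_mem_nhdsWithin, hlog.eventually_lt_atBot 0,
    (hlog.comp hscale).eventually_lt_atBot 0] with r hr hr1 hr2
  have hr : 0 < r := hr
  have hCr := hC (a * r) (mul_pos ha hr)
  simp only [Function.comp_apply] at hr2 ⊢
  have hne : Real.log r ≠ 0 := hr1.ne
  rw [Real.log_mul (by positivity) hCr.ne', Real.log_mul hk.ne' hr.ne']
  have h1 : Real.log (a * r) = Real.log a + Real.log r := Real.log_mul ha.ne' hr.ne'
  have h2 : Real.log a / Real.log r + 1 = Real.log (a * r) / Real.log r := by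
    rw [h1]; field_simp
  rw [h2, div_mul_div_cancel₀ hr2.ne]
  field_simp

/-- Passage from the suspension with height function `φ` to the unit suspension. -/
noncomputable def toUnitSusp {X : Type*} (φ : X → ℝ) (p : X × ℝ) : X × ℝ :=
  (p.1, p.2 / φ p.1)

/-- The fundamental domain `{(x, s) : 0 ≤ s < φ x}` of the suspension. -/
def suspDomain {X : Type*} (φ : X → ℝ) : Set (X × ℝ) :=
  {p | (toUnitSusp φ p).2 ∈ Set.Ico (0 : ℝ) 1}

section Domain

variable {X : Type*} {φ : X → ℝ}

theorem mem_suspDomain_iff (hφ : ∀ x, 0 < φ x) {p : X × ℝ} :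
    p ∈ suspDomain φ ↔ 0 ≤ p.2 ∧ p.2 < φ p.1 := by
  simp only [suspDomain, toUnitSusp, Set.mem_ofPred_eq, Set.mem_Ico, div_lt_one (hφ p.1)]
  rw [div_nonneg_iff]
  have := hφ p.1
  constructor
  · rintro ⟨h | h, h'⟩
    · exact ⟨h.1, h'⟩
    · linarith [h.2]
  · rintro ⟨h, h'⟩
    exact ⟨Or.inl ⟨h, this.le⟩, h'⟩

variable [MeasurableSpace X]

theorem measurable_toUnitSusp (hφ : Measurable φ) : Measurable (toUnitSusp φ) :=
  measurable_fst.prodMk (measurable_snd.div (hφ.comp measurable_fst))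

theorem measurableSet_suspDomain (hφ : Measurable φ) : MeasurableSet (suspDomain φ) :=
  (measurable_snd.comp (measurable_toUnitSusp hφ)) measurableSet_Ico

/-- The top of the suspension is negligible. -/
theorem restrict_eq_restrict_suspDomain {μ : Measure X} [SFinite μ] (hφ : Measurable φ)
    (hpos : ∀ x, 0 < φ x) :
    (μ.prod volume).restrict {p : X × ℝ | 0 ≤ p.2 ∧ p.2 ≤ φ p.1}
      = (μ.prod volume).restrict (suspDomain φ) := by
  refine Measure.restrict_congr_set ?_
  have hms : MeasurableSet {p : X × ℝ | p.2 = φ p.1} :=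
    measurableSet_eq_fun measurable_snd (hφ.comp measurable_fst)
  have hnull : (μ.prod volume) {p : X × ℝ | p.2 = φ p.1} = 0 := by
    refine (Measure.measure_prod_null hms).mpr (Eventually.of_forall fun x => ?_)
    exact Real.volume_singleton (a := φ x)
  have hne : ∀ᵐ p ∂(μ.prod volume), ¬ p.2 = φ p.1 := measure_eq_zero_iff_ae_notMem.mp hnull
  rw [Filter.eventuallyEq_set]
  filter_upwards [hne] with p hp
  rw [mem_suspDomain_iff hpos]
  exact ⟨fun h => ⟨h.1, lt_of_le_of_ne h.2 hp⟩, fun h => ⟨h.1, h.2.le⟩⟩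

theorem le_setLIntegral_suspDomain {μ : Measure X} [SFinite μ] {m : ℝ} (hm0 : 0 < m)
    (hm : ∀ x, m ≤ φ x) {h : X → ENNReal} (hh : Measurable h) :
    ENNReal.ofReal m * ∫⁻ x, h x ∂μ ≤ ∫⁻ p in suspDomain φ, h p.1 ∂(μ.prod volume) := by
  have hsub : Set.univ ×ˢ Set.Ico 0 m ⊆ suspDomain φ := fun p hp =>
    (mem_suspDomain_iff fun x => hm0.trans_le (hm x)).mpr ⟨hp.2.1, hp.2.2.trans_le (hm _)⟩
  refine le_trans (le_of_eq ?_) (lintegral_mono_set hsub)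
  rw [← Measure.prod_restrict, Measure.restrict_univ,
    lintegral_prod (fun p => h p.1) (hh.comp measurable_fst).aemeasurable]
  simp [lintegral_mul_const _ hh, mul_comm]

theorem setLIntegral_suspDomain_le {μ : Measure X} [SFinite μ] {M : ℝ} (hpos : ∀ x, 0 < φ x)
    (hM : ∀ x, φ x ≤ M) {h : X → ENNReal} (hh : Measurable h) :
    ∫⁻ p in suspDomain φ, h p.1 ∂(μ.prod volume) ≤ ENNReal.ofReal M * ∫⁻ x, h x ∂μ := by
  have hsub : suspDomain φ ⊆ Set.univ ×ˢ Set.Ico 0 M := fun p hp =>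
    have hp' := (mem_suspDomain_iff hpos).mp hp
    ⟨Set.mem_univ _, hp'.1, hp'.2.trans_le (hM _)⟩
  refine (lintegral_mono_set hsub).trans (le_of_eq ?_)
  rw [← Measure.prod_restrict, Measure.restrict_univ,
    lintegral_prod (fun p => h p.1) (hh.comp measurable_fst).aemeasurable]
  simp [lintegral_mul_const _ hh, mul_comm]

theorem le_prod_regionBetween_mul {μ : Measure X} [SFinite μ] (hφ : Measurable φ) {m : ℝ}
    (hm : ∀ x, m ≤ φ x) {A : Set X} (hA : MeasurableSet A) {α β : ℝ} (hαβ : α ≤ β) :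
    ENNReal.ofReal ((β - α) * m) * μ A ≤
      μ.prod volume (regionBetween (fun x => α * φ x) (fun x => β * φ x) A) := by
  rw [volume_regionBetween_eq_lintegral (hφ.const_mul α).aemeasurable
    (hφ.const_mul β).aemeasurable hA, ← setLIntegral_const]
  refine lintegral_mono fun x => ENNReal.ofReal_le_ofReal ?_
  have := mul_le_mul_of_nonneg_left (hm x) (sub_nonneg.mpr hαβ)
  simp only [Pi.sub_apply]
  linarith

theorem prod_regionBetween_mul_le {μ : Measure X} [SFinite μ] (hφ : Measurable φ) {M : ℝ}
    (hM : ∀ x, φ x ≤ M) {A : Set X} (hA : MeasurableSet A) {α β : ℝ} (hαβ : α ≤ β) :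
    μ.prod volume (regionBetween (fun x => α * φ x) (fun x => β * φ x) A) ≤
      ENNReal.ofReal ((β - α) * M) * μ A := by
  rw [volume_regionBetween_eq_lintegral (hφ.const_mul α).aemeasurable
    (hφ.const_mul β).aemeasurable hA, ← setLIntegral_const]
  refine lintegral_mono fun x => ENNReal.ofReal_le_ofReal ?_
  have := mul_le_mul_of_nonneg_left (hM x) (sub_nonneg.mpr hαβ)
  simp only [Pi.sub_apply]
  linarith

end Domain

section Measure

variable {X : Type*} [PseudoMetricSpace X] [MeasurableSpace X] [BorelSpace X]
  {e : Equiv.Perm X} {φ : X → ℝ}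

/-- The part in the fundamental domain of the Bowen–Walters ball of radius `r` around `p`. -/
def suspBall (e : Equiv.Perm X) (φ : X → ℝ) (r : ℝ) (p : X × ℝ) : Set (X × ℝ) :=
  {q | q ∈ suspDomain φ ∧ ∃ a < r, SegChain e (toUnitSusp φ p) (toUnitSusp φ q) a}

theorem exists_measurableSet_suspBall [SecondCountableTopology X] {L : ℝ}
    (hL : 1 ≤ L)
    (he : ∀ x y : X, dist (e x) (e y) ≤ L * dist x y) (hφ : Measurable φ) (r : ℝ) :
    ∃ E : Set ((X × ℝ) × X × ℝ), MeasurableSet E ∧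
      ∀ p ∈ suspDomain φ, Prod.mk p ⁻¹' E = suspBall e φ r p := by
  obtain ⟨U, hU, hUiff⟩ := exists_isOpen_segChain hL he r
  have hm := measurable_toUnitSusp hφ
  refine ⟨(Prod.map (toUnitSusp φ) (toUnitSusp φ) ⁻¹' U) ∩ (Prod.snd ⁻¹' suspDomain φ),
    ((hm.prodMap hm) hU.measurableSet).inter
      (measurable_snd (measurableSet_suspDomain hφ)), fun p hp => ?_⟩
  ext q
  have h := hUiff (toUnitSusp φ p, toUnitSusp φ q) hp
  simp only [Set.mem_preimage, Set.mem_inter_iff, Prod.map_apply, suspBall, Set.mem_ofPred_eq]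
  exact ⟨fun hq => ⟨hq.2, (h hq.2).mp hq.1⟩, fun hq => ⟨(h hq.1).mpr hq.2, hq.1⟩⟩

theorem le_measure_suspBall {L : ℝ} (hL : 1 ≤ L)
    (he : ∀ x y : X, dist (e x) (e y) ≤ L * dist x y) (hφ : Measurable φ)
    {μ : Measure X} [SFinite μ] {m : ℝ} (hm0 : 0 < m) (hm : ∀ x, m ≤ φ x)
    {p : X × ℝ} (hp : p ∈ suspDomain φ) {r : ℝ} (hr : 0 < r) (hr1 : r ≤ 1) :
    ENNReal.ofReal (r / 2 * m) * μ (ball p.1 (1 / (2 * L) * r)) ≤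
      μ.prod volume (suspBall e φ r p) := by
  obtain ⟨α, h0, h1, h2, h3⟩ : ∃ α : ℝ, 0 ≤ α ∧ α + r / 2 ≤ 1 ∧
      α ≤ (toUnitSusp φ p).2 ∧ (toUnitSusp φ p).2 ≤ α + r / 2 := by
    have hp' : (toUnitSusp φ p).2 ∈ Set.Ico (0 : ℝ) 1 := hp
    rcases le_total (toUnitSusp φ p).2 (1 / 2) with h | h
    · exact ⟨(toUnitSusp φ p).2, hp'.1, by linarith, le_rfl, by linarith⟩
    · exact ⟨(toUnitSusp φ p).2 - r / 2, by linarith, by linarith [hp'.2], by linarith,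
        by linarith⟩
  have h := le_prod_regionBetween_mul (μ := μ) hφ hm
    (measurableSet_ball (x := p.1) (ε := 1 / (2 * L) * r)) (show α ≤ α + r / 2 by linarith)
  rw [add_sub_cancel_left] at h
  refine h.trans (measure_mono ?_)
  rintro q ⟨hq1, hq2, hq3⟩
  have hφq : 0 < φ q.1 := hm0.trans_le (hm q.1)
  have hq2' : α < q.2 / φ q.1 := (lt_div_iff₀ hφq).mpr hq2
  have hq3' : q.2 / φ q.1 < α + r / 2 := (div_lt_iff₀ hφq).mpr hq3
  have hq : q ∈ suspDomain φ := ⟨by simp only [toUnitSusp]; linarith,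
    by simp only [toUnitSusp]; linarith⟩
  obtain ⟨a, ha, hc⟩ := exists_segChain_le hL he (p := toUnitSusp φ p) hq
  refine ⟨hq, a, lt_of_le_of_lt ha ?_, hc⟩
  have hd : L * dist p.1 q.1 < r / 2 := by
    rw [mem_ball, dist_comm] at hq1
    have hL0 : 0 < L := by linarith
    calc L * dist p.1 q.1 < L * (1 / (2 * L) * r) := mul_lt_mul_of_pos_left hq1 hL0
      _ = r / 2 := by field_simp
  have hv : |(toUnitSusp φ p).2 - (toUnitSusp φ q).2| ≤ r / 2 := by
    rw [abs_le]
    constructor <;> simp only [toUnitSusp] at * <;> linarith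
  simp only [toUnitSusp] at *
  linarith

theorem measure_suspBall_le {L : ℝ} (hL : 1 ≤ L)
    (he : ∀ x y : X, dist (e x) (e y) ≤ L * dist x y)
    (he' : ∀ x y : X, dist (e.symm x) (e.symm y) ≤ L * dist x y) (hφ : Measurable φ)
    (hφpos : ∀ x, 0 < φ x) {μ : Measure X} [SFinite μ] (hμ : MeasurePreserving e μ μ)
    {M : ℝ} (hM : ∀ x, φ x ≤ M)
    {p : X × ℝ} (hp : p ∈ suspDomain φ) {r : ℝ} (hr : 0 < r) (hr1 : r ≤ 1) :
    μ.prod volume (suspBall e φ r p) ≤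
      3 * (ENNReal.ofReal (2 * r * M) * μ (ball p.1 (L ^ 2 * r))) := by
  have he'c : Measurable e.symm :=
    (LipschitzWith.of_dist_le_mul (K := ⟨L, by linarith⟩) he').continuous.measurable
  have hμ' : MeasurePreserving e.symm μ μ :=
    MeasurePreserving.symm (MeasurableEquiv.mk e hμ.measurable he'c) hμ
  let A : ℤ → Set X := fun n => (e ^ (-n)) ⁻¹' ball p.1 (L ^ 2 * r)
  let R : ℤ → Set (X × ℝ) := fun n => regionBetween
    (fun x => ((toUnitSusp φ p).2 - n - r) * φ x) (fun x => ((toUnitSusp φ p).2 - n + r) * φ x)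
    (A n)
  have hR (n : ℤ) (hn : MeasurePreserving (e ^ (-n)) μ μ) :
      μ.prod volume (R n) ≤ ENNReal.ofReal (2 * r * M) * μ (ball p.1 (L ^ 2 * r)) := by
    have h := prod_regionBetween_mul_le (μ := μ) hφ hM (hn.measurable measurableSet_ball :
      MeasurableSet (A n)) (show (toUnitSusp φ p).2 - n - r ≤ (toUnitSusp φ p).2 - n + r by linarith)
    rw [hn.measure_preimage measurableSet_ball.nullMeasurableSet] at h
    convert h using 3
    ring
  have hsub : suspBall e φ r p ⊆ R (-1) ∪ R 0 ∪ R 1 := by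
    rintro q ⟨hq, a, ha, hc⟩
    obtain ⟨n, hn, hv, hd⟩ := hc.exists_lift hL he he' hp (ha.trans_le hr1)
    have hqn : q ∈ R n := by
      have hv' := abs_le.mp hv
      have hq2 : (toUnitSusp φ q).2 * φ q.1 = q.2 := by
        simp only [toUnitSusp]
        exact div_mul_cancel₀ _ (hφpos q.1).ne'
      refine ⟨?_, ?_, ?_⟩
      · exact lt_of_le_of_lt hd (mul_lt_mul_of_pos_left ha (by positivity))
      · rw [← hq2]
        exact mul_lt_mul_of_pos_right (by linarith) (hφpos q.1)
      · rw [← hq2]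
        exact mul_lt_mul_of_pos_right (by linarith) (hφpos q.1)
    rcases hn with rfl | rfl | rfl
    · exact Or.inl (Or.inl hqn)
    · exact Or.inl (Or.inr hqn)
    · exact Or.inr hqn
  have h1 := hR (-1) (by simpa using hμ)
  have h2 := hR 0 (by simpa using MeasurePreserving.id μ)
  have h3 := hR 1 (by simpa [Equiv.Perm.inv_def] using hμ')
  calc μ.prod volume (suspBall e φ r p)
      ≤ μ.prod volume (R (-1) ∪ R 0 ∪ R 1) := measure_mono hsub
    _ ≤ μ.prod volume (R (-1)) + μ.prod volume (R 0) + μ.prod volume (R 1) :=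
        (measure_union_le _ _).trans (add_le_add_left (measure_union_le _ _) _)
    _ ≤ _ := (add_le_add (add_le_add h1 h2) h3).trans (by ring_nf; exact le_rfl)

theorem measurable_measure_ball [SecondCountableTopology X] (μ : Measure X) [SFinite μ] (r : ℝ) :
    Measurable fun x => μ (ball x r) := by
  have h : IsOpen {w : X × X | dist w.2 w.1 < r} := isOpen_lt (by fun_prop) continuous_const
  exact measurable_measure_prodMk_left h.measurableSet

theorem ofReal_corrIntegral [SecondCountableTopology X] (μ : Measure X) [IsFiniteMeasure μ] (r : ℝ) :
    ENNReal.ofReal (corrIntegral μ r) = ∫⁻ x, μ (ball x r) ∂μ := by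
  have hfin : ∫⁻ x, μ (ball x r) ∂μ ≠ ⊤ := by
    refine ((lintegral_mono fun x => measure_mono (Set.subset_univ (ball x r))).trans_lt ?_).ne
    rw [lintegral_const]
    exact ENNReal.mul_lt_top (measure_lt_top _ _) (measure_lt_top _ _)
  rw [corrIntegral, integral_toReal (measurable_measure_ball μ r).aemeasurable
    (Eventually.of_forall fun x => measure_lt_top _ _), ENNReal.ofReal_toReal hfin]

theorem corrIntegral_pos [SecondCountableTopology X] (μ : Measure X) [IsFiniteMeasure μ] [NeZero μ] {r : ℝ} (hr : 0 < r) :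
    0 < corrIntegral μ r := by
  rw [← ENNReal.ofReal_pos, ofReal_corrIntegral, pos_iff_ne_zero]
  intro h
  rw [lintegral_eq_zero_iff (measurable_measure_ball μ r)] at h
  have : ∀ᵐ x ∂μ, x ∈ μ.support := Measure.support_mem_ae
  obtain ⟨x, hx, hx'⟩ := (h.and this).exists
  exact ((Measure.mem_support_iff_forall x).mp hx' _ (ball_mem_nhds x hr)).ne' hx

end Measure

/-- Two-sided comparison of the correlation integrals of the suspension and of the base. -/
theorem corrIntegral_susp_bounds {X : Type*} [PseudoMetricSpace X] [SecondCountableTopology X]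
    [MeasurableSpace X] [BorelSpace X] {e : Equiv.Perm X} {L : ℝ} (hL : 1 ≤ L)
    (he : ∀ x y : X, dist (e x) (e y) ≤ L * dist x y)
    (he' : ∀ x y : X, dist (e.symm x) (e.symm y) ≤ L * dist x y)
    {φ : X → ℝ} (hφ : Measurable φ) {m M : ℝ} (hm0 : 0 < m) (hM0 : 0 < M)
    (hm : ∀ x, m ≤ φ x) (hM : ∀ x, φ x ≤ M) {μ : Measure X} [IsFiniteMeasure μ] (hμ : MeasurePreserving e μ μ)
    {c : ℝ} (hc : 0 < c) {ν : Measure (X × ℝ)}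
    (hν : ν = ENNReal.ofReal c • (μ.prod volume).restrict (suspDomain φ))
    {r : ℝ} (hr : 0 < r) (hr1 : r ≤ 1) :
    (c ^ 2 * (m ^ 2 / 2)) * r * corrIntegral μ (1 / (2 * L) * r) ≤
        ∫ p, (ν {q | bwDist e φ p q < r}).toReal ∂ν ∧
      ∫ p, (ν {q | bwDist e φ p q < r}).toReal ∂ν ≤
        (c ^ 2 * (6 * M ^ 2)) * r * corrIntegral μ (L ^ 2 * r) := by
  have hpos : ∀ x, 0 < φ x := fun x => hm0.trans_le (hm x)
  have hS := measurableSet_suspDomain hφ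
  obtain ⟨E, hE, hEball⟩ := exists_measurableSet_suspBall hL he hφ r
  have hball (p : X × ℝ) (hp : p ∈ suspDomain φ) :
      ν {q | bwDist e φ p q < r} = ENNReal.ofReal c * μ.prod volume (Prod.mk p ⁻¹' E) := by
    rw [hν, Measure.smul_apply, Measure.restrict_apply' hS, smul_eq_mul, hEball p hp]
    congr 2
    ext q
    constructor
    · rintro ⟨h, hq⟩
      exact ⟨hq, (bwUnitDist_lt_iff hL he hp hq).mp h⟩
    · rintro ⟨hq, h⟩
      exact ⟨(bwUnitDist_lt_iff hL he hp hq).mpr h, hq⟩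
  have hνS : ∀ᵐ p ∂ν, p ∈ suspDomain φ := by
    rw [hν]
    exact Measure.ae_smul_measure (ae_restrict_mem hS) _
  have hlow (p : X × ℝ) (hp : p ∈ suspDomain φ) :
      ENNReal.ofReal (c * (r / 2 * m)) * μ (ball p.1 (1 / (2 * L) * r)) ≤
        ν {q | bwDist e φ p q < r} := by
    rw [hball p hp, hEball p hp, ENNReal.ofReal_mul hc.le, mul_assoc]
    gcongr
    exact le_measure_suspBall hL he hφ hm0 hm hp hr hr1
  have hup (p : X × ℝ) (hp : p ∈ suspDomain φ) :
      ν {q | bwDist e φ p q < r} ≤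
        ENNReal.ofReal (c * (3 * (2 * r * M))) * μ (ball p.1 (L ^ 2 * r)) := by
    rw [hball p hp, hEball p hp, ENNReal.ofReal_mul hc.le, mul_assoc,
      ENNReal.ofReal_mul (by norm_num : (0 : ℝ) ≤ 3), mul_assoc, ENNReal.ofReal_ofNat]
    gcongr
    exact measure_suspBall_le hL he he' hφ hpos hμ hM hp hr hr1
  have hmeas : AEMeasurable (fun p => ν {q | bwDist e φ p q < r}) ν := by
    refine ((measurable_measure_prodMk_left (ν := μ.prod volume) hE).const_mul
      (ENNReal.ofReal c)).aemeasurable.congr ?_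
    filter_upwards [hνS] with p hp using (hball p hp).symm
  have hfin : ∀ᵐ p ∂ν, ν {q | bwDist e φ p q < r} < ⊤ := by
    filter_upwards [hνS] with p hp
    exact (hup p hp).trans_lt (ENNReal.mul_lt_top ENNReal.ofReal_lt_top (measure_lt_top _ _))
  have hint (f : X × ℝ → ENNReal) :
      ∫⁻ p, f p ∂ν = ENNReal.ofReal c * ∫⁻ p in suspDomain φ, f p ∂(μ.prod volume) := by
    rw [hν, lintegral_smul_measure, smul_eq_mul]
  have hbm (s : ℝ) (k : ENNReal) : Measurable fun x => k * μ (ball x s) :=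
    (measurable_measure_ball μ s).const_mul k
  have hC0 (s : ℝ) : 0 ≤ corrIntegral μ s := integral_nonneg fun _ => ENNReal.toReal_nonneg
  have hUP : ∫⁻ p, ν {q | bwDist e φ p q < r} ∂ν ≤
      ENNReal.ofReal ((c ^ 2 * (6 * M ^ 2)) * r * corrIntegral μ (L ^ 2 * r)) := by
    calc ∫⁻ p, ν {q | bwDist e φ p q < r} ∂ν
        ≤ ∫⁻ p, ENNReal.ofReal (c * (3 * (2 * r * M))) * μ (ball p.1 (L ^ 2 * r)) ∂ν :=
          lintegral_mono_ae (hνS.mono hup)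
      _ ≤ ENNReal.ofReal c * (ENNReal.ofReal M *
            ∫⁻ x, ENNReal.ofReal (c * (3 * (2 * r * M))) * μ (ball x (L ^ 2 * r)) ∂μ) := by
          rw [hint]
          gcongr
          exact setLIntegral_suspDomain_le hpos hM (hbm _ _)
      _ = _ := by
          rw [lintegral_const_mul _ (measurable_measure_ball μ _), ← ofReal_corrIntegral,
            ← ENNReal.ofReal_mul (by positivity), ← ENNReal.ofReal_mul hM0.le,
            ← ENNReal.ofReal_mul hc.le]
          congr 1
          ring
  have hLOW : ENNReal.ofReal ((c ^ 2 * (m ^ 2 / 2)) * r * corrIntegral μ (1 / (2 * L) * r)) ≤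
      ∫⁻ p, ν {q | bwDist e φ p q < r} ∂ν := by
    calc _ = ENNReal.ofReal c * (ENNReal.ofReal m *
            ∫⁻ x, ENNReal.ofReal (c * (r / 2 * m)) * μ (ball x (1 / (2 * L) * r)) ∂μ) := by
          rw [lintegral_const_mul _ (measurable_measure_ball μ _), ← ofReal_corrIntegral,
            ← ENNReal.ofReal_mul (by positivity), ← ENNReal.ofReal_mul hm0.le,
            ← ENNReal.ofReal_mul hc.le]
          congr 1
          ring
      _ ≤ ∫⁻ p, ENNReal.ofReal (c * (r / 2 * m)) * μ (ball p.1 (1 / (2 * L) * r)) ∂ν := by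
          rw [hint]
          gcongr
          exact le_setLIntegral_suspDomain hm0 hm (hbm _ _)
      _ ≤ ∫⁻ p, ν {q | bwDist e φ p q < r} ∂ν := lintegral_mono_ae (hνS.mono hlow)
  rw [integral_toReal hmeas hfin]
  refine ⟨(ENNReal.ofReal_le_iff_le_toReal (hUP.trans_lt ENNReal.ofReal_lt_top).ne).mp hLOW,
    ENNReal.toReal_le_of_le_ofReal ?_ hUP⟩
  exact mul_nonneg (by positivity) (hC0 _)

/-- If the correlation dimension `C_μ` of the base measure exists, then the correlation
dimension of the suspension measure `ν` with respect to the Bowen–Walters metric exists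
and equals `C_μ + 1`. -/
theorem suspension_correlation_dimension {X : Type*} [MetricSpace X] [CompactSpace X]
    [Nonempty X] [MeasurableSpace X] [BorelSpace X]
    (e : Equiv.Perm X) (L : ℝ) (hL : 1 ≤ L)
    (heLip : ∀ x y : X, dist (e x) (e y) ≤ L * dist x y)
    (heSymmLip : ∀ x y : X, dist (e.symm x) (e.symm y) ≤ L * dist x y)
    (φ : X → ℝ) (hφpos : ∀ x, 0 < φ x)
    (hφLip : ∀ x y : X, |φ x - φ y| ≤ L * dist x y)
    (μ : Measure X) (hμprob : IsProbabilityMeasure μ)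
    (hμinv : MeasurePreserving e μ μ)
    (Cμ : ℝ)
    (hCμ : Tendsto (fun r : ℝ => Real.log (corrIntegral μ r) / Real.log r) (𝓝[>] 0) (𝓝 Cμ))
    (ν : Measure (X × ℝ))
    (hν : ν = (ENNReal.ofReal (∫ x, φ x ∂μ))⁻¹ •
      ((μ.prod volume).restrict {p : X × ℝ | 0 ≤ p.2 ∧ p.2 ≤ φ p.1})) :
    Tendsto
      (fun r : ℝ =>
        Real.log (∫ p, (ν {q | bwDist e φ p q < r}).toReal ∂ν) / Real.log r)
      (𝓝[>] 0) (𝓝 (Cμ + 1)) := by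
  have hLip : LipschitzWith ⟨L, by linarith⟩ φ := LipschitzWith.of_dist_le_mul hφLip
  have hφm : Measurable φ := hLip.continuous.measurable
  obtain ⟨xm, -, hxm⟩ := isCompact_univ.exists_isMinOn Set.univ_nonempty
    hLip.continuous.continuousOn
  obtain ⟨xM, -, hxM⟩ := isCompact_univ.exists_isMaxOn Set.univ_nonempty
    hLip.continuous.continuousOn
  have hm (x : X) : φ xm ≤ φ x := hxm (Set.mem_univ x)
  have hM (x : X) : φ x ≤ φ xM := hxM (Set.mem_univ x)
  have hint : Integrable φ μ :=
    hLip.continuous.integrable_of_hasCompactSupport (HasCompactSupport.of_compactSpace φ)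
  have hI : 0 < ∫ x, φ x ∂μ := by
    have h := integral_mono (integrable_const (φ xm)) hint hm
    rw [integral_const, probReal_univ, one_smul] at h
    exact (hφpos xm).trans_le h
  rw [restrict_eq_restrict_suspDomain hφm hφpos, ← ENNReal.ofReal_inv_of_pos hI] at hν
  have hc := inv_pos.mpr hI
  have hm0 := hφpos xm
  have hM0 := hφpos xM
  have hL0 : 0 < L := by linarith
  have hC (r : ℝ) (hr : 0 < r) : 0 < corrIntegral μ r := corrIntegral_pos μ hr
  have hbounds (r : ℝ) (hr : 0 < r) (hr1 : r ≤ 1) :=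
    corrIntegral_susp_bounds hL heLip heSymmLip hφm hm0 hM0 hm hM hμinv hc hν hr hr1
  refine tendsto_of_tendsto_of_tendsto_of_le_of_le'
    (tendsto_log_mul_comp_div_log (a := L ^ 2)
      (k := (∫ x, φ x ∂μ)⁻¹ ^ 2 * (6 * φ xM ^ 2)) (by positivity) (by positivity) hC hCμ)
    (tendsto_log_mul_comp_div_log (a := 1 / (2 * L))
      (k := (∫ x, φ x ∂μ)⁻¹ ^ 2 * (φ xm ^ 2 / 2)) (by positivity) (by positivity) hC hCμ) ?_ ?_
  all_goals
    filter_upwards [Ioo_mem_nhdsGT one_pos] with r hr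
    obtain ⟨h1, h2⟩ := hbounds r hr.1 hr.2.le
    have hr0 := hr.1
    have hlow : 0 < ((∫ x, φ x ∂μ)⁻¹ ^ 2 * (φ xm ^ 2 / 2)) * r
        * corrIntegral μ (1 / (2 * L) * r) :=
      mul_pos (by positivity) (hC _ (by positivity))
    have hlog := (Real.log_neg hr.1 hr.2).le
  · exact div_le_div_of_nonpos_of_le hlog (Real.log_le_log (hlow.trans_le h1) h2)
  · exact div_le_div_of_nonpos_of_le hlog (Real.log_le_log hlow h1)
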